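/- arXiv:2206.07657 — 2 statements merged into one kernel-verified Lean document; each statement's English description precedes it below -/
import Mathlib

section
/- The fractal interpolation function f (the unique fixed point of T in 𝔽) interpolates the data: f(t_n) = x_n for every n = 0, 1, …, N. -/
open Set

/-- The affine contraction `L_n : I → I_n` determined by `L_n(t_0) = t_{n-1}`, `L_n(t_N) = t_n`. -/
noncomputable def Lmap (t : ℕ → ℝ) (N n : ℕ) (s : ℝ) : ℝ :=
  t (n - 1) + (t n - t (n - 1)) * (s - t 0) / (t N - t 0)

/-- The inverse map `L_n⁻¹ : I_n → I`. -/
noncomputable def LmapInv (t : ℕ → ℝ) (N n : ℕ) (y : ℝ) : ℝ :=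
  t 0 + (t N - t 0) * (y - t (n - 1)) / (t n - t (n - 1))

theorem LmapInv_right (t : ℕ → ℝ) (N : ℕ) {n : ℕ} (h : t (n - 1) < t n) :
    LmapInv t N n (t n) = t N := by
  rw [LmapInv, mul_div_cancel_right₀ _ (sub_pos.2 h).ne', add_sub_cancel]

/-- the fractal interpolation function `f` (the unique fixed point of `T`
in `𝔽`) interpolates the data: `f(t_n) = x_n` for every `n = 0, 1, …, N`. -/
theorem fif_interpolates_data
    (N : ℕ) (hN : 2 ≤ N) (t x : ℕ → ℝ)
    (ht : ∀ i, i < N → t i < t (i + 1))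
    (α : ℕ → ℝ) (q : ℕ → ℝ → ℝ)
    (hα : ∀ n, 1 ≤ n → n ≤ N → |α n| < 1)
    (hq : ∀ n, 1 ≤ n → n ≤ N → ContinuousOn (q n) (Icc (t 0) (t N)))
    (hend : ∀ n, 1 ≤ n → n ≤ N →
      α n * x 0 + q n (t 0) = x (n - 1) ∧ α n * x N + q n (t N) = x n)
    (f : ℝ → ℝ)
    (hf : ContinuousOn f (Icc (t 0) (t N)))
    (hf0 : f (t 0) = x 0) (hfN : f (t N) = x N)
    (hfix : ∀ n, 1 ≤ n → n ≤ N → ∀ u ∈ Icc (t (n - 1)) (t n),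
      f u = α n * f (LmapInv t N n u) + q n (LmapInv t N n u)) :
    ∀ n, n ≤ N → f (t n) = x n := by
  intro n hn
  rcases n with _ | k
  · exact hf0
  have hlt : t (k + 1 - 1) < t (k + 1) := ht k hn
  rw [hfix (k + 1) k.succ_pos hn _ (right_mem_Icc.2 hlt.le), LmapInv_right t N hlt, hfN]
  exact (hend (k + 1) k.succ_pos hn).2
end

section
/- Let f be the fractal interpolation function (the unique fixed point of T in 𝔽) and let G = {(t, f(t)) : t ∈ I} ⊆ ℝ² be its graph. Define w_n : I × ℝ → ℝ² by w_n(t, x) = (L_n(t), F_n(t, x)) for n = 1,…,N. Then G is invariant under the iterated function system: G = ⋃_{n=1}^{N} w_n(G), i.e. G = ⋃_{n=1}^{N} {(L_n(t), F_n(t, f(t))) : t ∈ I}. -/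
open Set

theorem le_of_forall_lt_succ {t : ℕ → ℝ} {N : ℕ} (ht : ∀ i, i < N → t i < t (i + 1))
    {i j : ℕ} (hij : i ≤ j) (hj : j ≤ N) : t i ≤ t j := by
  induction j, hij using Nat.le_induction with
  | base => exact le_rfl
  | succ k _ ih => exact (ih (by omega)).trans (ht k (by omega)).le

theorem exists_mem_Icc_pred {t : ℕ → ℝ} {N : ℕ} (hN : 1 ≤ N) {u : ℝ}
    (hu : u ∈ Icc (t 0) (t N)) : ∃ n, 1 ≤ n ∧ n ≤ N ∧ u ∈ Icc (t (n - 1)) (t n) := by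
  induction N, hN using Nat.le_induction with
  | base => exact ⟨1, le_rfl, le_rfl, hu⟩
  | succ k _ ih =>
    rcases le_total u (t k) with h | h
    · obtain ⟨n, h1, h2, h3⟩ := ih ⟨hu.1, h⟩
      exact ⟨n, h1, by omega, h3⟩
    · exact ⟨k + 1, by omega, le_rfl, h, hu.2⟩

theorem Lmap_LmapInv {t : ℕ → ℝ} {N n : ℕ} (hN : t 0 < t N) (hn : t (n - 1) < t n) (y : ℝ) :
    Lmap t N n (LmapInv t N n y) = y := by
  have h1 := (sub_pos.2 hN).ne'
  have h2 := (sub_pos.2 hn).ne'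
  unfold Lmap LmapInv
  field_simp
  ring

theorem LmapInv_Lmap {t : ℕ → ℝ} {N n : ℕ} (hN : t 0 < t N) (hn : t (n - 1) < t n) (s : ℝ) :
    LmapInv t N n (Lmap t N n s) = s := by
  have h1 := (sub_pos.2 hN).ne'
  have h2 := (sub_pos.2 hn).ne'
  unfold Lmap LmapInv
  field_simp
  ring

theorem add_mul_sub_div_mem_Icc {a b c d s : ℝ} (hab : a < b) (hcd : c ≤ d)
    (hs : s ∈ Icc a b) : c + (d - c) * (s - a) / (b - a) ∈ Icc c d := by
  have hba := sub_pos.2 hab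
  have hdc := sub_nonneg.2 hcd
  have hsa := sub_nonneg.2 hs.1
  have hle : (d - c) * (s - a) / (b - a) ≤ d - c := by
    rw [div_le_iff₀ hba]
    exact mul_le_mul_of_nonneg_left (by linarith [hs.2]) hdc
  have hnonneg : 0 ≤ (d - c) * (s - a) / (b - a) := by positivity
  constructor <;> linarith

/-- the graph `G = {(t, f(t)) : t ∈ I}` of the fractal interpolation
function `f` is invariant under the IFS `w_n(t, x) = (L_n(t), F_n(t, x))`:
`G = ⋃_{n=1}^{N} w_n(G)`. -/
theorem fif_graph_ifs_invariant
    (N : ℕ) (hN : 2 ≤ N) (t x : ℕ → ℝ)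
    (ht : ∀ i, i < N → t i < t (i + 1))
    (α : ℕ → ℝ) (q : ℕ → ℝ → ℝ)
    (hα : ∀ n, 1 ≤ n → n ≤ N → |α n| < 1)
    (hq : ∀ n, 1 ≤ n → n ≤ N → ContinuousOn (q n) (Icc (t 0) (t N)))
    (hend : ∀ n, 1 ≤ n → n ≤ N →
      α n * x 0 + q n (t 0) = x (n - 1) ∧ α n * x N + q n (t N) = x n)
    (f : ℝ → ℝ)
    (hf : ContinuousOn f (Icc (t 0) (t N)))
    (hf0 : f (t 0) = x 0) (hfN : f (t N) = x N)
    (hfix : ∀ n, 1 ≤ n → n ≤ N → ∀ u ∈ Icc (t (n - 1)) (t n),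
      f u = α n * f (LmapInv t N n u) + q n (LmapInv t N n u)) :
    (fun u : ℝ => (u, f u)) '' Icc (t 0) (t N) =
      ⋃ n ∈ Finset.Icc 1 N,
        (fun p : ℝ × ℝ => (Lmap t N n p.1, α n * p.2 + q n p.1)) ''
          ((fun u : ℝ => (u, f u)) '' Icc (t 0) (t N)) := by
  have hlt : ∀ n, 1 ≤ n → n ≤ N → t (n - 1) < t n := fun n h1 h2 => by
    have h := ht (n - 1) (by omega)
    rwa [Nat.sub_add_cancel h1] at h
  have h0N : t 0 < t N :=
    (ht 0 (by omega)).trans_le (le_of_forall_lt_succ ht (by omega) le_rfl)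
  ext p
  simp only [mem_image, mem_iUnion, Finset.mem_Icc, exists_prop]
  constructor
  · rintro ⟨u, hu, rfl⟩
    obtain ⟨n, h1, h2, hun⟩ := exists_mem_Icc_pred (by omega) hu
    refine ⟨n, ⟨h1, h2⟩, _, ⟨LmapInv t N n u,
      add_mul_sub_div_mem_Icc (hlt n h1 h2) h0N.le hun, rfl⟩, ?_⟩
    exact Prod.ext (Lmap_LmapInv h0N (hlt n h1 h2) u) (hfix n h1 h2 u hun).symm
  · rintro ⟨n, ⟨h1, h2⟩, _, ⟨s, hs, rfl⟩, rfl⟩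
    have hmem : Lmap t N n s ∈ Icc (t (n - 1)) (t n) :=
      add_mul_sub_div_mem_Icc h0N (hlt n h1 h2).le hs
    refine ⟨Lmap t N n s, ⟨(le_of_forall_lt_succ ht (Nat.zero_le _) (by omega)).trans hmem.1,
      hmem.2.trans (le_of_forall_lt_succ ht h2 le_rfl)⟩, Prod.ext rfl ?_⟩
    have h := hfix n h1 h2 _ hmem
    rwa [LmapInv_Lmap h0N (hlt n h1 h2)] at h
end
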